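/- Let Σ be a symmetric positive definite real matrix indexed by V×V. Let a, c, z ∈ V be distinct and B ⊆ V \ {a, c, z}. Assume Σ_{az} = 0 (i.e., a ⟂⟂ z). Suppose there exists x ∈ V \ (B ∪ {a, c, z}) such that σ_{uw|{x}} = 0 for every u ∈ {a, z} and every w ∈ {c} ∪ B (i.e., {a, z} ⟂⟂ {c} ∪ B | x). Then ρ²_{ac|B} ≤ ρ²_{ac|B∪{z}}. -/

import Mathlib

open Matrix

variable {V : Type*}

/-- Partial covariance `σ_{uv|Z} = Σ_{uv} − Σ_{uZ} (Σ_{ZZ})⁻¹ Σ_{Zv}`. -/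
noncomputable def pcov [Fintype V] [DecidableEq V] (S : Matrix V V ℝ) (u v : V) (Z : Finset V) : ℝ :=
  S u v - ∑ i : {x // x ∈ Z}, ∑ j : {x // x ∈ Z},
    S u (i : V) * (Matrix.of (fun i j : {x // x ∈ Z} => S (i : V) (j : V)))⁻¹ i j * S (j : V) v

/-- Squared partial correlation `ρ²_{uv|Z}`. -/
noncomputable def rho2 [Fintype V] [DecidableEq V] (S : Matrix V V ℝ) (u v : V) (Z : Finset V) : ℝ :=
  pcov S u v Z ^ 2 / (pcov S u u Z * pcov S v v Z)

section PartialCovariance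

lemma isUnit_det_principal [DecidableEq V] {S : Matrix V V ℝ} (hpd : S.PosDef) (Z : Finset V) :
    IsUnit (Matrix.of (fun i j : {x // x ∈ Z} => S (i : V) (j : V))).det :=
  (Matrix.isUnit_iff_isUnit_det _).1
    (hpd.submatrix (e := ((↑) : {x // x ∈ Z} → V)) Subtype.val_injective).isUnit

/-- The normal equations for regressing `u` on `Z` are solvable. -/
lemma exists_regression [DecidableEq V] {S : Matrix V V ℝ} (hpd : S.PosDef) (u : V)
    (Z : Finset V) :
    ∃ β : V → ℝ, ∀ j ∈ Z, ∑ i ∈ Z, β i * S i j = S u j := by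
  set M := Matrix.of (fun i j : {x // x ∈ Z} => S (i : V) (j : V)) with hM
  set b := (fun j : {x // x ∈ Z} => S u j) ᵥ* M⁻¹ with hb
  have hbM : b ᵥ* M = fun j : {x // x ∈ Z} => S u j := by
    rw [hb, Matrix.vecMul_vecMul, Matrix.nonsing_inv_mul _ (isUnit_det_principal hpd Z),
      Matrix.vecMul_one]
  refine ⟨fun i => if hi : i ∈ Z then b ⟨i, hi⟩ else 0, fun j hj => ?_⟩
  rw [← Finset.sum_coe_sort, ← congrFun hbM ⟨j, hj⟩]
  simp [Matrix.vecMul, dotProduct, hM]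

variable [Fintype V] [DecidableEq V] {S : Matrix V V ℝ}

/-- Any solution of the normal equations computes the partial covariances. -/
lemma pcov_eq_of_regression (hpd : S.PosDef) {Z : Finset V} {u : V} {β : V → ℝ}
    (hβ : ∀ j ∈ Z, ∑ i ∈ Z, β i * S i j = S u j) (v : V) :
    pcov S u v Z = S u v - ∑ i ∈ Z, β i * S i v := by
  set M := Matrix.of (fun i j : {x // x ∈ Z} => S (i : V) (j : V)) with hM
  have hrow : (fun i : {x // x ∈ Z} => β i) ᵥ* M = fun j : {x // x ∈ Z} => S u j := by
    ext j
    rw [← hβ j j.2, ← Finset.sum_coe_sort]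
    rfl
  have hsol : (fun j : {x // x ∈ Z} => S u j) ᵥ* M⁻¹ = fun i : {x // x ∈ Z} => β i := by
    rw [← hrow, Matrix.vecMul_vecMul, Matrix.mul_nonsing_inv _ (isUnit_det_principal hpd Z),
      Matrix.vecMul_one]
  have hβ' (j : {x // x ∈ Z}) : ∑ i : {x // x ∈ Z}, S u i * M⁻¹ i j = β j := congrFun hsol j
  rw [pcov, ← hM, Finset.sum_comm, ← Finset.sum_coe_sort Z]
  simp_rw [← Finset.sum_mul, hβ']

lemma pcov_comm (hsym : S.IsSymm) (hpd : S.PosDef) (u v : V) (Z : Finset V) :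
    pcov S u v Z = pcov S v u Z := by
  obtain ⟨β, hβ⟩ := exists_regression hpd u Z
  obtain ⟨γ, hγ⟩ := exists_regression hpd v Z
  rw [pcov_eq_of_regression hpd hβ, pcov_eq_of_regression hpd hγ, hsym.apply v u]
  congr 1
  calc ∑ i ∈ Z, β i * S i v = ∑ i ∈ Z, ∑ j ∈ Z, β i * (γ j * S j i) :=
        Finset.sum_congr rfl fun i hi => by rw [hsym.apply v i, ← hγ i hi, Finset.mul_sum]
    _ = ∑ j ∈ Z, ∑ i ∈ Z, γ j * (β i * S i j) := by
        rw [Finset.sum_comm]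
        exact Finset.sum_congr rfl fun j _ => Finset.sum_congr rfl fun i _ => by
          rw [hsym.apply i j]; ring
    _ = ∑ j ∈ Z, γ j * S j u :=
        Finset.sum_congr rfl fun j hj => by rw [← Finset.mul_sum, hβ j hj, hsym.apply j u]

lemma pcov_self_le (hpd : S.PosDef) (hsym : S.IsSymm) (u : V) (Z : Finset V) :
    pcov S u u Z ≤ S u u := by
  obtain ⟨β, hβ⟩ := exists_regression hpd u Z
  rw [pcov_eq_of_regression hpd hβ, sub_le_self_iff]
  set γ : V → ℝ := fun i => if i ∈ Z then β i else 0 with hγ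
  have hnn := hpd.posSemidef.dotProduct_mulVec_nonneg γ
  refine hnn.trans_eq ?_
  rw [Matrix.dotProduct_mulVec]
  simp only [Matrix.vecMul, dotProduct, hγ, star_trivial, ite_mul, mul_ite, zero_mul, mul_zero,
    Finset.sum_ite_mem, Finset.univ_inter]
  exact Finset.sum_congr rfl fun j hj => by rw [hβ j hj, hsym.apply j u, mul_comm]

lemma pcov_self_pos (hpd : S.PosDef) {u : V} {Z : Finset V} (hu : u ∉ Z) :
    0 < pcov S u u Z := by
  obtain ⟨β, hβ⟩ := exists_regression hpd u Z
  set γ : V → ℝ := fun i => if i ∈ Z then -β i else if i = u then 1 else 0 with hγ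
  have hγu : γ u = 1 := by simp [hγ, hu]
  have hγ0 : γ ≠ 0 := fun h => by simp [h] at hγu
  have hrow (v : V) : (γ ᵥ* S) v = pcov S u v Z := by
    have hsplit (i : V) : γ i * S i v =
        (if i = u then S i v else 0) - (if i ∈ Z then β i * S i v else 0) := by
      by_cases hi : i ∈ Z
      · have : i ≠ u := fun h => hu (h ▸ hi)
        simp [hγ, hi, this]
      · simp [hγ, hi]
    rw [pcov_eq_of_regression hpd hβ]
    simp [Matrix.vecMul, dotProduct, hsplit, Finset.sum_sub_distrib]
  have hpos := hpd.dotProduct_mulVec_pos hγ0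
  rw [Matrix.dotProduct_mulVec, star_trivial] at hpos
  refine hpos.trans_eq ?_
  rw [dotProduct, Finset.sum_eq_single u _ (by simp), hrow, hγu, mul_one]
  intro v _ hv
  rw [hrow]
  by_cases hvZ : v ∈ Z
  · rw [pcov_eq_of_regression hpd hβ, hβ v hvZ, sub_self, zero_mul]
  · simp [hγ, hvZ, hv]

/-- Recursion for partial covariances under enlarging the conditioning set by one element. -/
lemma pcov_insert (hpd : S.PosDef) {z : V} {Z : Finset V} (hz : z ∉ Z) (u v : V) :
    pcov S u v (insert z Z) =
      pcov S u v Z - pcov S u z Z * pcov S z v Z / pcov S z z Z := by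
  obtain ⟨β, hβ⟩ := exists_regression hpd u Z
  obtain ⟨γ, hγ⟩ := exists_regression hpd z Z
  have hzz := (pcov_self_pos hpd hz).ne'
  set k := pcov S u z Z / pcov S z z Z with hk
  have hkz : k * pcov S z z Z = pcov S u z Z := div_mul_cancel₀ _ hzz
  set δ : V → ℝ := fun i => if i = z then k else β i - k * γ i with hδ
  have hsum (w : V) : ∑ i ∈ insert z Z, δ i * S i w =
      S u w - (pcov S u w Z - k * pcov S z w Z) := by
    have hZ : ∑ i ∈ Z, δ i * S i w = ∑ i ∈ Z, β i * S i w - k * ∑ i ∈ Z, γ i * S i w := by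
      rw [Finset.mul_sum, ← Finset.sum_sub_distrib]
      refine Finset.sum_congr rfl fun i hi => ?_
      have : i ≠ z := fun h => hz (h ▸ hi)
      simp only [hδ, this, if_false]
      ring
    rw [Finset.sum_insert hz, hZ, pcov_eq_of_regression hpd hβ, pcov_eq_of_regression hpd hγ]
    simp only [hδ, if_true]
    ring
  have hreg : ∀ j ∈ insert z Z, ∑ i ∈ insert z Z, δ i * S i j = S u j := by
    intro j hj
    rw [hsum]
    rcases Finset.mem_insert.1 hj with rfl | hj
    · rw [hkz]; ring
    · rw [pcov_eq_of_regression hpd hβ, pcov_eq_of_regression hpd hγ, hβ j hj, hγ j hj]; ring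
  rw [pcov_eq_of_regression hpd hreg, hsum, hk]
  ring

end PartialCovariance

/-- Theorem 4 (ii), first part: with `a ⟂⟂ z` and `{a,z} ⟂⟂ {c} ∪ B | x`,
`ρ²_{ac|B} ≤ ρ²_{ac|B∪{z}}`. -/
theorem stmt_6 [Fintype V] [DecidableEq V] [Nonempty V]
    (S : Matrix V V ℝ) (hsym : S.IsSymm) (hpd : S.PosDef)
    (a c z : V) (hac : a ≠ c) (haz : a ≠ z) (hcz : c ≠ z)
    (B : Finset V) (haB : a ∉ B) (hcB : c ∉ B) (hzB : z ∉ B)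
    (hSaz : S a z = 0)
    (h : ∃ x : V, x ∉ B ∧ x ≠ a ∧ x ≠ c ∧ x ≠ z ∧
      ∀ u ∈ ({a, z} : Finset V), ∀ w ∈ insert c B, pcov S u w {x} = 0) :
    rho2 S a c B ≤ rho2 S a c (insert z B) := by
  obtain ⟨x, -, -, -, -, hx⟩ := h
  have hxx : S x x ≠ 0 := hpd.diag_pos.ne'
  have hprop (u : V) (hu : u ∈ ({a, z} : Finset V)) (w : V) (hw : w ∈ insert c B) :
      S u w = S u x / S x x * S x w := by
    have hreg : ∀ j ∈ ({x} : Finset V),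
        ∑ i ∈ ({x} : Finset V), (fun _ => S u x / S x x) i * S i j = S u j := by
      intro j hj
      rw [Finset.mem_singleton.1 hj, Finset.sum_singleton, div_mul_cancel₀ _ hxx]
    have hzero := hx u hu w hw
    rw [pcov_eq_of_regression hpd hreg, Finset.sum_singleton] at hzero
    exact sub_eq_zero.1 hzero
  obtain ⟨β, hβ⟩ := exists_regression hpd x B
  have hcov (u : V) (hu : u ∈ ({a, z} : Finset V)) (v : V) :
      pcov S u v B = S u v - S u x / S x x * ∑ i ∈ B, β i * S i v := by
    have hreg : ∀ j ∈ B, ∑ i ∈ B, (S u x / S x x * β i) * S i j = S u j := by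
      intro j hj
      simp_rw [mul_assoc]
      rw [← Finset.mul_sum, hβ j hj, ← hprop u hu j (Finset.mem_insert_of_mem hj)]
    rw [pcov_eq_of_regression hpd hreg, Finset.mul_sum]
    simp_rw [mul_assoc]
  have ha : a ∈ ({a, z} : Finset V) := by simp
  have hz : z ∈ ({a, z} : Finset V) := by simp
  have hGz : ∑ i ∈ B, β i * S i z = S z x / S x x * ∑ i ∈ B, β i * S i x := by
    rw [Finset.mul_sum]
    refine Finset.sum_congr rfl fun i hi => ?_
    rw [hsym.apply z i, hprop z hz i (Finset.mem_insert_of_mem hi), hsym.apply i x]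
    ring
  have hc : c ∈ insert c B := Finset.mem_insert_self c B
  have hac' := hcov a ha c
  have hzc' := hcov z hz c
  have haz' := hcov a ha z
  have hzz' := hcov z hz z
  rw [hprop a ha c hc] at hac'
  rw [hprop z hz c hc] at hzc'
  rw [hSaz, hGz] at haz'
  rw [hGz] at hzz'
  have hzpos := pcov_self_pos hpd hzB
  have hapos := pcov_self_pos hpd haB
  have hcpos := pcov_self_pos hpd hcB
  have hnum : pcov S a c (insert z B) = pcov S a c B * (S z z / pcov S z z B) := by
    rw [pcov_insert hpd hzB]
    field_simp
    rw [hac', hzc', haz', hzz']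
    ring
  have hle (u : V) : pcov S u u (insert z B) ≤ pcov S u u B := by
    rw [pcov_insert hpd hzB, pcov_comm hsym hpd z u B, sub_le_self_iff]
    exact div_nonneg (mul_self_nonneg _) hzpos.le
  have hapos' : 0 < pcov S a a (insert z B) := pcov_self_pos hpd (by simp [haz, haB])
  have hcpos' : 0 < pcov S c c (insert z B) := pcov_self_pos hpd (by simp [hcz, hcB])
  have hratio : 1 ≤ S z z / pcov S z z B := (one_le_div hzpos).2 (pcov_self_le hpd hsym z B)
  unfold rho2
  refine div_le_div₀ (sq_nonneg _) ?_ (mul_pos hapos' hcpos')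
    (mul_le_mul (hle a) (hle c) hcpos'.le hapos.le)
  rw [hnum, mul_pow]
  exact le_mul_of_one_le_right (sq_nonneg _) (one_le_pow₀ hratio)
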